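/- arXiv:math/0403332 — 2 statements merged into one kernel-verified Lean document; each statement's English description precedes it below -/
import Mathlib

section
/- Let N ≥ 2. The canonical equivalence relation R_N of F(N) is ergodic with respect to Lebesgue measure: every Borel set X ⊆ [0,1] such that f(x) ∈ X for every x ∈ X and every f ∈ F(N) satisfies λ(X) = 0 or λ(X) = 1. -/
/-- A real number is an `N`-adic rational if it equals `k / N^m` for some `k : ℤ`, `m : ℕ`. -/
def IsNAdic (N : ℕ) (x : ℝ) : Prop :=
  ∃ (k : ℤ) (m : ℕ), x = (k : ℝ) / (N : ℝ) ^ m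

/-- Membership (as a map of `[0,1]`) in the generalized Thompson group `F(N)`:
`f 0 = 0`, `f 1 = 1`, and there is a finite partition `0 = a 0 < a 1 < ⋯ < a n = 1`
of `[0,1]` by `N`-adic rationals such that on each piece `[a i, a (i+1)]` the map `f`
is affine with slope an integer power of `N`.  (Such an `f` is automatically an
increasing piecewise-linear homeomorphism of `[0,1]` onto itself, with all
non-differentiability points `N`-adic.) -/
def InFN (N : ℕ) (f : ℝ → ℝ) : Prop :=
  f 0 = 0 ∧ f 1 = 1 ∧
    ∃ (n : ℕ) (a : ℕ → ℝ), 0 < n ∧ a 0 = 0 ∧ a n = 1 ∧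
      (∀ i < n, a i < a (i + 1)) ∧
      (∀ i ≤ n, IsNAdic N (a i)) ∧
      (∀ i < n, ∃ q : ℤ, ∀ x ∈ Set.Icc (a i) (a (i + 1)),
        f x = f (a i) + (N : ℝ) ^ q * (x - a i))

open MeasureTheory Set Filter

lemma IsNAdic.intCast (N : ℕ) (k : ℤ) : IsNAdic N k := ⟨k, 0, by simp⟩

lemma IsNAdic.inv_pow (N m : ℕ) : IsNAdic N (1 / (N : ℝ) ^ m) := ⟨1, m, by simp⟩

lemma IsNAdic.neg {N : ℕ} {x : ℝ} (hx : IsNAdic N x) : IsNAdic N (-x) := by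
  obtain ⟨k, m, rfl⟩ := hx
  exact ⟨-k, m, by push_cast; ring⟩

lemma IsNAdic.add {N : ℕ} (hN : N ≠ 0) {x y : ℝ} (hx : IsNAdic N x) (hy : IsNAdic N y) :
    IsNAdic N (x + y) := by
  obtain ⟨k, m, rfl⟩ := hx
  obtain ⟨l, n, rfl⟩ := hy
  have : (N : ℝ) ≠ 0 := by exact_mod_cast hN
  refine ⟨k * N ^ n + l * N ^ m, m + n, ?_⟩
  push_cast
  field_simp
  ring

lemma IsNAdic.sub {N : ℕ} (hN : N ≠ 0) {x y : ℝ} (hx : IsNAdic N x) (hy : IsNAdic N y) :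
    IsNAdic N (x - y) := by
  rw [sub_eq_add_neg]
  exact hx.add hN hy.neg

lemma IsNAdic.natCast_mul {N : ℕ} (l : ℕ) {x : ℝ} (hx : IsNAdic N x) : IsNAdic N (l * x) := by
  obtain ⟨k, m, rfl⟩ := hx
  exact ⟨l * k, m, by push_cast; ring⟩

/-- The map which is affine on `[0, b]`, `[b, c]`, `[c, 1]`, with slopes `N ^ q`, `1`, `N ^ r`,
belongs to `F(N)` as soon as it fixes `1`. -/
lemma inFN_three_pieces {N : ℕ} {b c : ℝ} (q r : ℤ) (hb : IsNAdic N b) (hc : IsNAdic N c)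
    (h0b : 0 < b) (hbc : b < c) (hc1 : c < 1)
    (h1 : (N : ℝ) ^ q * b + (c - b) + (N : ℝ) ^ r * (1 - c) = 1) :
    InFN N (fun x ↦ if x ≤ b then (N : ℝ) ^ q * x else
      if x ≤ c then (N : ℝ) ^ q * b + (x - b) else
        (N : ℝ) ^ q * b + (c - b) + (N : ℝ) ^ r * (x - c)) := by
  refine ⟨by simp [h0b.le], ?_, 3,
    fun i ↦ if i = 0 then 0 else if i = 1 then b else if i = 2 then c else 1,
    by norm_num, by simp, by simp, ?_, ?_, ?_⟩
  · simp [(hbc.trans hc1).not_ge, hc1.not_ge, h1]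
  · intro i hi
    interval_cases i <;> simpa
  · intro i hi
    interval_cases i
    · simpa using IsNAdic.intCast N 0
    · simpa
    · simpa
    · simpa using IsNAdic.intCast N 1
  · intro i hi
    interval_cases i
    · refine ⟨q, fun x hx ↦ ?_⟩
      have : x ≤ b := by simpa using hx.2
      simp [this, h0b.le]
    · refine ⟨0, fun x hx ↦ ?_⟩
      have hx1 : b ≤ x := by simpa using hx.1
      have hx2 : x ≤ c := by simpa using hx.2
      rcases hx1.eq_or_lt with rfl | h
      · simp
      · simp [h.not_ge, hx2]
    · refine ⟨r, fun x hx ↦ ?_⟩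
      have hx1 : c ≤ x := by simpa using hx.1
      rcases hx1.eq_or_lt with rfl | h
      · simp
      · simp [h.not_ge, (hbc.trans h).not_ge, hbc.not_ge]

section Invariant

variable {N : ℕ} {X : Set ℝ}

/-- A set invariant under `F(N)` is locally invariant under translation by `(N - 1) u`. -/
lemma mem_iff_add_mem (hN : 2 ≤ N) (hXsat : ∀ x ∈ X, ∀ f : ℝ → ℝ, InFN N f → f x ∈ X)
    {u x : ℝ} (hu : IsNAdic N u) (hu0 : 0 < u) (hx : u < x) (hx' : x + (N - 1) * u < 1 - u) :
    x ∈ X ↔ x + (N - 1) * u ∈ X := by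
  have hN2 : (2 : ℝ) ≤ N := by exact_mod_cast hN
  have hN0 : N ≠ 0 := by omega
  have hNu : 0 < (N - 1) * u := by nlinarith
  have h1 : IsNAdic N 1 := by simpa using IsNAdic.intCast N 1
  have hNN : IsNAdic N (N * u) := hu.natCast_mul N
  constructor <;> intro h
  · have key := hXsat _ h _ (inFN_three_pieces (b := u) (c := 1 - N * u) 1 (-1) hu
      (h1.sub hN0 hNN) hu0 (by linarith) (by nlinarith) (by
        rw [zpow_neg, zpow_one]; field_simp; ring))
    rw [if_neg hx.not_ge, if_pos (by linarith)] at key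
    convert key using 1
    rw [zpow_one]; ring
  · have key := hXsat _ h _ (inFN_three_pieces (b := N * u) (c := 1 - u) (-1) 1 hNN
      (h1.sub hN0 hu) (by nlinarith) (by linarith) (by linarith) (by
        rw [zpow_neg, zpow_one]; field_simp; ring))
    rw [if_neg (by linarith), if_pos (by linarith)] at key
    convert key using 1
    rw [zpow_neg, zpow_one]; field_simp; ring

lemma mem_iff_add_nat_mul_mem (hN : 2 ≤ N) (hXsat : ∀ x ∈ X, ∀ f : ℝ → ℝ, InFN N f → f x ∈ X)
    {u x : ℝ} (hu : IsNAdic N u) (hu0 : 0 < u) (hx : u < x) (k : ℕ)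
    (hx' : x + k * ((N - 1) * u) < 1 - u) :
    x ∈ X ↔ x + k * ((N - 1) * u) ∈ X := by
  have hN2 : (2 : ℝ) ≤ N := by exact_mod_cast hN
  have hNu : 0 < (N - 1) * u := by nlinarith
  induction k with
  | zero => simp
  | succ k ih =>
    have e : x + (k + 1 : ℕ) * ((N - 1) * u) = x + k * ((N - 1) * u) + (N - 1) * u := by
      push_cast; ring
    rw [e] at hx' ⊢
    have hk : 0 ≤ k * ((N - 1) * u) := by positivity
    exact (ih (by linarith)).trans
      (mem_iff_add_mem hN hXsat hu hu0 (by linarith) hx')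

/-- A set invariant under `F(N)` is invariant, within `(0, 1)`, under all translations by
`(N - 1) g` with `g` an `N`-adic rational. -/
lemma mem_iff_mem_of_sub_eq (hN : 2 ≤ N) (hXsat : ∀ x ∈ X, ∀ f : ℝ → ℝ, InFN N f → f x ∈ X)
    {x y g : ℝ} (hx : x ∈ Ioo 0 1) (hy : y ∈ Ioo 0 1) (hg : IsNAdic N g)
    (hxy : y - x = (N - 1) * g) : x ∈ X ↔ y ∈ X := by
  wlog hle : x ≤ y generalizing x y g
  · exact (this hy hx hg.neg (by linarith) (le_of_not_ge hle)).symm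
  have hN2 : (2 : ℝ) ≤ N := by exact_mod_cast hN
  obtain ⟨k, m, rfl⟩ := hg
  have hm : (0 : ℝ) < (N : ℝ) ^ m := by positivity
  have hk : 0 ≤ k := by
    have h : 0 ≤ (N - 1 : ℝ) * (k / (N : ℝ) ^ m) := by linarith
    have h' := nonneg_of_mul_nonneg_right h (by linarith)
    have : (0 : ℝ) ≤ k := by
      have := mul_nonneg h' hm.le
      rwa [div_mul_cancel₀ _ hm.ne'] at this
    exact_mod_cast this
  lift k to ℕ using hk
  obtain ⟨j, hj⟩ := exists_pow_lt_of_lt_one (lt_min hx.1 (sub_pos.2 hy.2))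
    (show (1 / N : ℝ) < 1 by rw [div_lt_one] <;> linarith)
  obtain ⟨hjx, hjy⟩ := lt_min_iff.1 hj
  have hu : 1 / (N : ℝ) ^ (m + j) ≤ (1 / N : ℝ) ^ j := by
    rw [div_pow, one_pow]
    exact one_div_le_one_div_of_le (by positivity)
      (pow_le_pow_right₀ (by linarith) (by omega))
  have e : y = x + (k * N ^ j : ℕ) * ((N - 1) * (1 / (N : ℝ) ^ (m + j))) := by
    have : y = x + (N - 1) * (k / (N : ℝ) ^ m) := by
      rw [← sub_eq_iff_eq_add', hxy, Int.cast_natCast]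
    rw [this, pow_add]
    push_cast
    field_simp
  have key := mem_iff_add_nat_mul_mem hN hXsat (IsNAdic.inv_pow N (m + j)) (by positivity)
    (hu.trans_lt hjx) (k * N ^ j) (by rw [← e]; linarith)
  rwa [← e] at key

end Invariant

lemma dense_setOf_nAdic_mul {N : ℕ} (hN : 2 ≤ N) :
    Dense {x : ℝ | ∃ g, IsNAdic N g ∧ x = (N - 1) * g} := by
  have hN0 : N ≠ 0 := by omega
  have hN2 : (2 : ℝ) ≤ N := by exact_mod_cast hN
  let S : AddSubgroup ℝ :=
    { carrier := {x : ℝ | ∃ g, IsNAdic N g ∧ x = (N - 1) * g}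
      zero_mem' := ⟨0, by simpa using IsNAdic.intCast N 0, by simp⟩
      add_mem' := by
        rintro _ _ ⟨g, hg, rfl⟩ ⟨h, hh, rfl⟩
        exact ⟨g + h, hg.add hN0 hh, by ring⟩
      neg_mem' := by
        rintro _ ⟨g, hg, rfl⟩
        exact ⟨-g, hg.neg, by ring⟩ }
  refine S.dense_of_not_isolated_zero fun ε hε ↦ ?_
  obtain ⟨j, hj⟩ := exists_pow_lt_of_lt_one (show 0 < ε / (N - 1) from div_pos hε (by linarith))
    (show (1 / N : ℝ) < 1 by rw [div_lt_one] <;> linarith)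
  rw [div_pow, one_pow, lt_div_iff₀' (by linarith)] at hj
  exact ⟨_, ⟨_, IsNAdic.inv_pow N j, rfl⟩, mul_pos (by linarith) (by positivity), hj⟩

/-- A measurable set of reals which is periodic, and invariant under a dense set of translations,
is null or conull on each period. -/
lemma eventuallyConst_of_dense_translations {p : ℝ} [Fact (0 < p)] {Y : Set ℝ}
    (hY : MeasurableSet Y) {D : Set ℝ} (hD : Dense D) (hp : p ∈ D)
    (hinv : ∀ d ∈ D, ∀ y, d + y ∈ Y ↔ y ∈ Y) :
    EventuallyConst Y (ae (volume.restrict (Ioc 0 p))) := by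
  have hper : ∀ x y : ℝ, (x : AddCircle p) = y → (x ∈ Y ↔ y ∈ Y) := by
    intro x y hxy
    have hz : Function.Periodic (· ∈ Y) p := fun z ↦ propext (by rw [add_comm]; exact hinv p hp z)
    rw [← sub_eq_zero, ← AddCircle.coe_sub, AddCircle.coe_eq_zero_iff] at hxy
    obtain ⟨n, hn⟩ := hxy
    rw [eq_add_of_sub_eq' hn.symm]
    exact iff_of_eq (hz.zsmul n y)
  let S : Set (AddCircle p) := (fun y : ℝ ↦ (y : AddCircle p)) '' Y
  have hS : (fun y : ℝ ↦ (y : AddCircle p)) ⁻¹' S = Y := by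
    ext x
    constructor
    · rintro ⟨y, hy, hyx⟩
      exact (hper y x hyx).1 hy
    · exact fun hx ↦ ⟨x, hx, rfl⟩
  have hSm : MeasurableSet S := measurableSet_quotient.2 (by exact hS ▸ hY)
  have hmem : ∀ x : ℝ, (x : AddCircle p) ∈ S ↔ x ∈ Y := fun x ↦ by
    conv_rhs => rw [← hS]
    rfl
  have hd : Dense {g : AddCircle p | (g +ᵥ ·) ⁻¹' S = S} := by
    have : DenseRange (fun y : ℝ ↦ (y : AddCircle p)) :=
      (QuotientAddGroup.mk_surjective).denseRange
    refine (this.dense_image (AddCircle.continuous_mk' p) hD).mono ?_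
    rintro _ ⟨d, hd, rfl⟩
    ext z
    induction z using QuotientAddGroup.induction_on with
    | H z =>
      change ((d : AddCircle p) + (z : AddCircle p)) ∈ S ↔ (z : AddCircle p) ∈ S
      rw [← AddCircle.coe_add, hmem, hmem, hinv d hd]
  have hconst := aeconst_of_dense_setOfPred_preimage_vadd_eq (μ := (volume : Measure (AddCircle p)))
    hSm.nullMeasurableSet hd
  have hmp := AddCircle.measurePreserving_mk p 0
  rw [zero_add] at hmp
  have := hconst.comp_tendsto hmp.quasiMeasurePreserving.tendsto_ae
  rw [← hS]
  exact this

/-- The canonical equivalence relation `R_N` of `F(N)` is ergodic for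
Lebesgue measure: every Borel set `X ⊆ [0,1]` invariant under all elements of `F(N)`
has measure `0` or `1`. -/
theorem statement11 (N : ℕ) (hN : 2 ≤ N) (X : Set ℝ) (hX : X ⊆ Set.Icc (0 : ℝ) 1)
    (hXmeas : MeasurableSet X)
    (hXsat : ∀ x ∈ X, ∀ f : ℝ → ℝ, InFN N f → f x ∈ X) :
    MeasureTheory.volume X = 0 ∨ MeasureTheory.volume X = 1 := by
  have hN0 : N ≠ 0 := by omega
  have hN2 : (2 : ℝ) ≤ N := by exact_mod_cast hN
  let Y : Set ℝ := ⋃ (k : ℤ) (m : ℕ), (fun y : ℝ ↦ y + (N - 1) * (k / (N : ℝ) ^ m)) ⁻¹'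
    (X ∩ Ioo 0 1)
  have hYmem : ∀ y, y ∈ Y ↔ ∃ g, IsNAdic N g ∧ y + (N - 1) * g ∈ X ∩ Ioo 0 1 := by
    intro y
    simp only [Y, mem_iUnion, mem_preimage]
    constructor
    · rintro ⟨k, m, h⟩
      exact ⟨_, ⟨k, m, rfl⟩, h⟩
    · rintro ⟨_, ⟨k, m, rfl⟩, h⟩
      exact ⟨k, m, h⟩
  have hY : MeasurableSet Y := .iUnion fun k ↦ .iUnion fun m ↦
    (measurable_id.add_const _) (hXmeas.inter measurableSet_Ioo)
  have hXY : ∀ x ∈ Ioo (0 : ℝ) 1, x ∈ Y ↔ x ∈ X := by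
    intro x hx
    rw [hYmem]
    constructor
    · rintro ⟨g, hg, h⟩
      exact (mem_iff_mem_of_sub_eq hN hXsat hx h.2 hg (by ring)).2 h.1
    · intro h
      exact ⟨0, by simpa using IsNAdic.intCast N 0, by simpa using ⟨h, hx⟩⟩
  have : Fact ((0 : ℝ) < N - 1) := ⟨by linarith⟩
  have hconst := eventuallyConst_of_dense_translations (p := (N : ℝ) - 1) hY
    (dense_setOf_nAdic_mul hN) ⟨1, by simpa using IsNAdic.intCast N 1, by simp⟩ (by
      rintro _ ⟨d, hd, rfl⟩ y
      rw [hYmem, hYmem]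
      constructor
      · rintro ⟨g, hg, h⟩
        exact ⟨d + g, hd.add hN0 hg, by convert h using 1; ring⟩
      · rintro ⟨g, hg, h⟩
        exact ⟨g - d, hg.sub hN0 hd, by convert h using 1; ring⟩)
  have hconst' : EventuallyConst Y (ae (volume.restrict (Ioo (0 : ℝ) 1))) :=
    hconst.anti <| ae_mono <| Measure.restrict_mono
      (Ioo_subset_Ioc_self.trans (Ioc_subset_Ioc_right (by linarith))) le_rfl
  have hXvol : volume X = volume (X ∩ Ioo 0 1) := by
    rw [← Measure.restrict_apply hXmeas, Measure.restrict_congr_set Ioo_ae_eq_Icc,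
      Measure.restrict_apply hXmeas, inter_eq_left.2 hX]
  rw [hXvol]
  rcases eventuallyConst_set.1 hconst' with h | h <;>
    rw [ae_restrict_iff' measurableSet_Ioo] at h
  · right
    have : (X ∩ Ioo 0 1 : Set ℝ) =ᵐ[volume] Ioo (0 : ℝ) 1 := by
      filter_upwards [h] with x hx
      exact propext ⟨fun h ↦ h.2, fun h ↦ ⟨(hXY x h).1 (hx h), h⟩⟩
    rw [measure_congr this]
    simp
  · left
    rw [measure_eq_zero_iff_ae_notMem]
    filter_upwards [h] with x hx hx'
    exact hx hx'.2 ((hXY x hx'.2).2 hx'.1)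
end

section
/- Let N ≥ 2 and let g : [0,1] → [0,∞) be a Borel measurable function such that for every T ∈ F(N) one has g(x) = g(T(x))·T'(x) for Lebesgue-almost every x ∈ [0,1] (T is differentiable off a finite set, so this makes sense a.e.). Then g = 0 Lebesgue-almost everywhere. -/
open MeasureTheory

open Filter Topology

/-- The map with slope `N` on `[0, p]`, slope `1` on `[p, 1 - N p]` and slope `1 / N` on
`[1 - N p, 1]`. -/
noncomputable def shiftMap (N : ℕ) (p x : ℝ) : ℝ :=
  if x ≤ p then N * x else if x ≤ 1 - N * p then x + (N - 1) * p else 1 + (x - 1) / N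

theorem inFN_shiftMap {N : ℕ} (hN : 2 ≤ N) {p : ℝ} (hp : 0 < p) (hp1 : (N + 1) * p < 1)
    (hpN : IsNAdic N p) : InFN N (shiftMap N p) := by
  have hN2 : (2 : ℝ) ≤ N := by exact_mod_cast hN
  have hN0 : (N : ℝ) ≠ 0 := by positivity
  have hp2 : p < 1 - N * p := by linarith
  have hNp : 0 < N * p := by positivity
  refine ⟨by simp [shiftMap, hp.le], ?_, 3,
    fun i => if i = 0 then 0 else if i = 1 then p else if i = 2 then 1 - N * p else 1,
    by norm_num, by simp, by simp, ?_, ?_, ?_⟩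
  · have h1 : ¬ (1 : ℝ) ≤ p := by linarith
    have h2 : ¬ (1 : ℝ) ≤ 1 - N * p := by linarith
    simp [shiftMap, h1, hp, (by linarith : 0 < N)]
  · intro i hi
    interval_cases i <;> simp <;> linarith
  · obtain ⟨k, m, hk⟩ := hpN
    intro i hi
    interval_cases i
    · exact ⟨0, 0, by simp⟩
    · exact ⟨k, m, by simpa using hk⟩
    · refine ⟨(N : ℤ) ^ m - N * k, m, ?_⟩
      simp only [hk]
      push_cast
      field_simp
    · exact ⟨1, 0, by simp⟩
  · intro i hi
    interval_cases i
    · refine ⟨1, fun x hx => ?_⟩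
      simp at hx
      simp [shiftMap, hx.2, hp.le]
    · refine ⟨0, fun x hx => ?_⟩
      simp at hx
      rcases hx.1.eq_or_lt with rfl | h
      · simp
      · simp [shiftMap, hx.2, not_le.2 h]
        ring
    · refine ⟨-1, fun x hx => ?_⟩
      simp at hx
      rcases hx.1.eq_or_lt with h | h
      · obtain rfl : x = 1 - N * p := by linarith
        simp
      · have h1 : ¬ x ≤ p := by linarith
        have h2 : ¬ x ≤ 1 - N * p := by linarith
        have h3 : ¬ 1 - N * p ≤ p := by linarith
        simp [shiftMap, h1, h2, h3]
        field_simp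
        ring

theorem deriv_shiftMap_left {N : ℕ} {p x : ℝ} (hx : x < p) : deriv (shiftMap N p) x = N := by
  have : shiftMap N p =ᶠ[𝓝 x] fun y => N * y := by
    filter_upwards [eventually_lt_nhds hx] with y hy
    simp [shiftMap, hy.le]
  rw [this.deriv_eq]
  simp

theorem deriv_shiftMap_middle {N : ℕ} {p x : ℝ} (hx : p < x) (hx' : x < 1 - N * p) :
    deriv (shiftMap N p) x = 1 := by
  have : shiftMap N p =ᶠ[𝓝 x] fun y => y + (N - 1) * p := by
    filter_upwards [eventually_gt_nhds hx, eventually_lt_nhds hx'] with y hy hy'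
    simp [shiftMap, not_le.2 hy, hy'.le]
  rw [this.deriv_eq]
  simp

/-- A continuous function whose increments over steps `(N - 1) / N ^ m` do not depend on the
base point is additive on `[0, 1]`. -/
theorem additive_of_increments {N : ℕ} (hN : 2 ≤ N) {F : ℝ → ℝ} (hF : Continuous F)
    (hF0 : F 0 = 0)
    (hinc : ∀ m : ℕ, 2 ≤ m → ∀ p : ℝ, p = 1 / (N : ℝ) ^ m →
      ∀ x ∈ Set.Icc p (1 - N * p), ∀ y ∈ Set.Icc p (1 - N * p),
        F (x + (N - 1) * p) - F x = F (y + (N - 1) * p) - F y)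
    {x t : ℝ} (hx : 0 < x) (ht : 0 < t) (hxt : x + t ≤ 1) : F (x + t) = F x + F t := by
  have hN2 : (2 : ℝ) ≤ N := by exact_mod_cast hN
  set p : ℕ → ℝ := fun m => 1 / (N : ℝ) ^ m with hp
  have hp0 : ∀ m, 0 < p m := fun m => by positivity
  have hplim : Tendsto p atTop (𝓝 0) := by
    have := tendsto_pow_atTop_nhds_zero_of_lt_one (r := 1 / (N : ℝ)) (by positivity)
      (by rw [div_lt_one (by positivity)]; linarith)
    simpa [hp] using this
  set j : ℕ → ℕ := fun m => ⌊(t - p m) / ((N - 1) * p m)⌋₊ with hj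
  have hs0 : ∀ m, 0 < (N - 1) * p m := fun m => mul_pos (by linarith) (hp0 m)
  have hle : ∀ m, p m < t → j m * ((N - 1) * p m) ≤ t - p m := fun m hm => by
    rw [← le_div_iff₀ (hs0 m)]
    exact Nat.floor_le (div_nonneg (by linarith) (hs0 m).le)
  have hge : ∀ m, t - p m - (N - 1) * p m ≤ j m * ((N - 1) * p m) := fun m => by
    have := (Nat.lt_floor_add_one ((t - p m) / ((N - 1) * p m))).le
    rw [div_le_iff₀ (hs0 m)] at this
    linarith
  have hpt : ∀ᶠ m in atTop, p m < t := hplim.eventually (eventually_lt_nhds ht)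
  have hpx : ∀ᶠ m in atTop, p m < x := hplim.eventually (eventually_lt_nhds hx)
  have hjlim : Tendsto (fun m => j m * ((N - 1) * p m)) atTop (𝓝 t) := by
    refine tendsto_of_tendsto_of_tendsto_of_le_of_le' (g := fun m => t - p m - (N - 1) * p m)
      (h := fun m => t - p m) ?_ ?_ (Eventually.of_forall hge) (hpt.mono hle)
    · simpa using (tendsto_const_nhds.sub hplim).sub (hplim.const_mul ((N : ℝ) - 1))
    · simpa using tendsto_const_nhds.sub hplim
  have heq : ∀ᶠ m in atTop, F (x + j m * ((N - 1) * p m)) - F x =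
      F (p m + j m * ((N - 1) * p m)) - F (p m) := by
    filter_upwards [hpt, hpx, eventually_ge_atTop 2] with m hmt hmx hm
    have hs := hs0 m
    have key : ∀ i : ℕ, i * ((N - 1) * p m) ≤ t - p m →
        F (x + i * ((N - 1) * p m)) - F x = F (p m + i * ((N - 1) * p m)) - F (p m) := by
      intro i
      induction i with
      | zero => simp
      | succ i ih =>
        intro hi
        push_cast at hi ⊢
        have hi0 : 0 ≤ i * ((N - 1) * p m) := by positivity
        have h1 := ih (by linarith)
        have h2 := hinc m hm (p m) rfl (x + i * ((N - 1) * p m)) ⟨by linarith, by linarith⟩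
          (p m + i * ((N - 1) * p m)) ⟨by linarith, by linarith⟩
        have e : ∀ z : ℝ, z + (i + 1) * ((N - 1) * p m) =
          z + i * ((N - 1) * p m) + (N - 1) * p m := fun z => by ring
        rw [e, e]
        linarith
    exact key _ (hle m hmt)
  have hl : Tendsto (fun m => F (x + j m * ((N - 1) * p m)) - F x) atTop
      (𝓝 (F (x + t) - F x)) :=
    ((hF.tendsto _).comp (tendsto_const_nhds.add hjlim)).sub_const _
  have hr : Tendsto (fun m => F (p m + j m * ((N - 1) * p m)) - F (p m)) atTop
      (𝓝 (F (0 + t) - F 0)) :=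
    ((hF.tendsto _).comp (hplim.add hjlim)).sub ((hF.tendsto _).comp hplim)
  have := tendsto_nhds_unique (hl.congr' heq) hr
  rw [zero_add, hF0] at this
  linarith

section Truncation

variable {g : ℝ → ℝ}

theorem intervalIntegrable_min_mul_one (hgmeas : Measurable g) (hg : ∀ x, 0 ≤ g x) {c : ℝ}
    (hc : 0 ≤ c) (a b : ℝ) : IntervalIntegrable (fun x => min (c * g x) 1) volume a b := by
  refine (intervalIntegrable_const (c := (1 : ℝ))).mono_fun
    ((hgmeas.const_mul c).min measurable_const).aestronglyMeasurable (ae_of_all _ fun x => ?_)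
  have : 0 ≤ min (c * g x) 1 := le_min (mul_nonneg hc (hg x)) zero_le_one
  simp [abs_of_nonneg this]

/-- A.e. local invariance under a translation makes the increments of the primitive of a
truncation of `g` independent of the base point. -/
theorem integral_truncation_increment (hgmeas : Measurable g) (hg : ∀ x, 0 ≤ g x) {c : ℝ}
    (hc : 0 ≤ c) {a b s : ℝ}
    (hinv : ∀ᵐ x, x ∈ Set.Ioo a b → g x = g (x + s))
    {x y : ℝ} (hx : x ∈ Set.Icc a b) (hy : y ∈ Set.Icc a b) :
    (∫ u in (0 : ℝ)..(x + s), min (c * g u) 1) - ∫ u in (0 : ℝ)..x, min (c * g u) 1 =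
      (∫ u in (0 : ℝ)..(y + s), min (c * g u) 1) - ∫ u in (0 : ℝ)..y, min (c * g u) 1 := by
  have hi := intervalIntegrable_min_mul_one hgmeas hg hc
  have h1 := intervalIntegral.integral_interval_sub_left (hi 0 x) (hi 0 y)
  have h2 := intervalIntegral.integral_interval_sub_left (hi 0 (x + s)) (hi 0 (y + s))
  have h3 : ∫ u in y..x, min (c * g u) 1 = ∫ u in y..x, min (c * g (u + s)) 1 := by
    refine intervalIntegral.integral_congr_ae ?_
    have hb : ∀ᵐ u : ℝ, u ≠ a ∧ u ≠ b := by
      refine (Measure.ae_ne volume a).and (Measure.ae_ne volume b)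
    filter_upwards [hinv, hb] with u hu hub huxy
    have hu' := Set.uIcc_subset_Icc hy hx (Set.uIoc_subset_uIcc huxy)
    rw [← hu ⟨lt_of_le_of_ne hu'.1 (Ne.symm hub.1), lt_of_le_of_ne hu'.2 hub.2⟩]
  rw [intervalIntegral.integral_comp_add_right (fun u => min (c * g u) 1)] at h3
  linarith

theorem integral_truncation_scale {N : ℕ} (hN : N ≠ 0) {c p : ℝ} (hp : 0 ≤ p)
    (hinv : ∀ᵐ x, x ∈ Set.Ioo 0 p → g x = g (N * x) * N) :
    ∫ u in (0 : ℝ)..p, min (c * g u) 1 =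
      (N : ℝ)⁻¹ * ∫ u in (0 : ℝ)..(N * p), min (c * N * g u) 1 := by
  have h3 : ∫ u in (0 : ℝ)..p, min (c * g u) 1 =
      ∫ u in (0 : ℝ)..p, min (c * N * g (N * u)) 1 := by
    refine intervalIntegral.integral_congr_ae ?_
    filter_upwards [hinv, Measure.ae_ne volume p] with u hu hup huI
    rw [Set.uIoc_of_le hp] at huI
    rw [hu ⟨huI.1, lt_of_le_of_ne huI.2 hup⟩, mul_comm (g _) (N : ℝ), mul_assoc]
  rw [h3, intervalIntegral.integral_comp_mul_left (fun u => min (c * N * g u) 1)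
    (by exact_mod_cast hN : (N : ℝ) ≠ 0)]
  simp

theorem tendsto_integral_truncation (hgmeas : Measurable g) (hg : ∀ x, 0 ≤ g x) {c : ℕ → ℝ}
    (hc0 : ∀ k, 0 ≤ c k) (hc : Tendsto c atTop (𝓝 0)) (a b : ℝ) :
    Tendsto (fun k => ∫ u in a..b, min (c k * g u) 1) atTop (𝓝 0) := by
  have := intervalIntegral.tendsto_integral_filter_of_dominated_convergence
    (μ := volume) (a := a) (b := b) (l := atTop) (F := fun k u => min (c k * g u) 1)
    (f := fun _ => (0 : ℝ)) (fun _ => 1)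
    (Eventually.of_forall fun k =>
      ((hgmeas.const_mul (c k)).min measurable_const).aestronglyMeasurable)
    (Eventually.of_forall fun k => ae_of_all _ fun u _ => by
      have : 0 ≤ min (c k * g u) 1 := le_min (mul_nonneg (hc0 k) (hg u)) zero_le_one
      simp [abs_of_nonneg this])
    intervalIntegrable_const
    (ae_of_all _ fun u _ => by
      have := (hc.mul_const (g u)).min (tendsto_const_nhds (x := (1 : ℝ)))
      simpa using this)
  simpa using this

end Truncation

/-- If `g : [0,1] → [0,∞)` is Borel measurable and for every
`T ∈ F(N)` one has `g(x) = g(T(x))·T'(x)` for Lebesgue-a.e. `x ∈ [0,1]`, then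
`g = 0` Lebesgue-almost everywhere on `[0,1]`. -/
theorem statement13 (N : ℕ) (hN : 2 ≤ N) (g : ℝ → ℝ)
    (hgmeas : Measurable g) (hgnonneg : ∀ x, 0 ≤ g x)
    (hinv : ∀ T : ℝ → ℝ, InFN N T →
      ∀ᵐ x ∂(volume.restrict (Set.Icc (0 : ℝ) 1)), g x = g (T x) * deriv T x) :
    ∀ᵐ x ∂(volume.restrict (Set.Icc (0 : ℝ) 1)), g x = 0 := by
  have hN2 : (2 : ℝ) ≤ N := by exact_mod_cast hN
  have hpm : ∀ m : ℕ, 2 ≤ m → ((N : ℝ) + 1) * (1 / (N : ℝ) ^ m) < 1 := fun m hm => by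
    have : (N : ℝ) ^ 2 ≤ (N : ℝ) ^ m := pow_le_pow_right₀ (by linarith) hm
    rw [mul_one_div, div_lt_one (by positivity)]
    nlinarith
  have hmem : ∀ m : ℕ, 2 ≤ m → InFN N (shiftMap N (1 / (N : ℝ) ^ m)) := fun m hm =>
    inFN_shiftMap hN (by positivity) (hpm m hm) ⟨1, m, by simp⟩
  have hae : ∀ m : ℕ, 2 ≤ m → ∀ᵐ x, x ∈ Set.Icc (0 : ℝ) 1 →
      g x = g (shiftMap N (1 / (N : ℝ) ^ m) x) * deriv (shiftMap N (1 / (N : ℝ) ^ m)) x :=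
    fun m hm => (ae_restrict_iff' measurableSet_Icc).1 (hinv _ (hmem m hm))
  have hadd : ∀ c : ℝ, 0 ≤ c → ∀ x t : ℝ, 0 < x → 0 < t → x + t ≤ 1 →
      ∫ u in (0 : ℝ)..(x + t), min (c * g u) 1 =
        (∫ u in (0 : ℝ)..x, min (c * g u) 1) + ∫ u in (0 : ℝ)..t, min (c * g u) 1 := by
    intro c hc x t hx ht hxt
    refine additive_of_increments (F := fun x => ∫ u in (0 : ℝ)..x, min (c * g u) 1) hN
      (intervalIntegral.continuous_primitive
        (intervalIntegrable_min_mul_one hgmeas hgnonneg hc) 0) (by simp) ?_ hx ht hxt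
    rintro m hm p rfl x hx y hy
    refine integral_truncation_increment hgmeas hgnonneg hc ?_ hx hy
    filter_upwards [hae m hm] with u hu hum
    have hp : 0 < 1 / (N : ℝ) ^ m := by positivity
    have hNp : 0 < N * (1 / (N : ℝ) ^ m) := by positivity
    rw [hu ⟨by linarith [hum.1], by linarith [hum.2]⟩, deriv_shiftMap_middle hum.1 hum.2, mul_one,
      shiftMap, if_neg (not_le.2 hum.1), if_pos hum.2.le]
  set p : ℝ := 1 / (N : ℝ) ^ 2 with hpdef
  have hp : 0 < p := by positivity
  have hNp : N ^ 2 * p = 1 := by rw [hpdef]; field_simp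
  have hp1 := hpm 2 le_rfl
  rw [← hpdef] at hp1
  have hmul : ∀ c : ℝ, 0 ≤ c → ∀ k : ℕ, k * p ≤ 1 →
      ∫ u in (0 : ℝ)..(k * p), min (c * g u) 1 = k * ∫ u in (0 : ℝ)..p, min (c * g u) 1 := by
    intro c hc k
    induction k with
    | zero => simp
    | succ k ih =>
      intro hk
      push_cast at hk ⊢
      rcases Nat.eq_zero_or_pos k with rfl | hk0
      · simp
      · have hk1 : (0 : ℝ) < k * p := by positivity
        rw [add_mul, one_mul, hadd c hc _ _ hk1 hp (by linarith), ih (by linarith)]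
        ring
  have hscale : ∀ c : ℝ, 0 ≤ c →
      ∫ u in (0 : ℝ)..p, min (c * g u) 1 = ∫ u in (0 : ℝ)..p, min (c * N * g u) 1 := by
    intro c hc
    rw [integral_truncation_scale (N := N) (by omega) hp.le, hmul (c * N) (by positivity) N
      (by linarith), inv_mul_cancel_left₀ (by positivity)]
    filter_upwards [hae 2 le_rfl] with u hu hum
    rw [hu ⟨hum.1.le, by nlinarith [hum.2]⟩, deriv_shiftMap_left hum.2, shiftMap,
      if_pos hum.2.le]
  have hzero : ∫ u in (0 : ℝ)..p, min (1 * g u) 1 = 0 := by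
    have hk : ∀ k : ℕ, ∫ u in (0 : ℝ)..p, min ((1 / (N : ℝ)) ^ k * g u) 1 =
        ∫ u in (0 : ℝ)..p, min (1 * g u) 1 := by
      intro k
      induction k with
      | zero => simp
      | succ k ih =>
        rw [hscale _ (by positivity), ← ih, pow_succ, mul_assoc _ (1 / (N : ℝ)),
          one_div_mul_cancel (by positivity), mul_one]
    have hlim := tendsto_integral_truncation hgmeas hgnonneg
      (c := fun k => (1 / (N : ℝ)) ^ k) (fun k => by positivity)
      (tendsto_pow_atTop_nhds_zero_of_lt_one (by positivity)
        (by rw [div_lt_one (by positivity)]; linarith)) 0 p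
    simp only [hk] at hlim
    exact tendsto_nhds_unique tendsto_const_nhds hlim
  have hone := hmul 1 zero_le_one (N ^ 2) (by push_cast; exact hNp.le)
  push_cast at hone
  rw [hzero, mul_zero, hNp, intervalIntegral.integral_eq_zero_iff_of_le_of_nonneg_ae zero_le_one
    (ae_of_all _ fun u => le_min (mul_nonneg zero_le_one (hgnonneg u)) zero_le_one)
    (intervalIntegrable_min_mul_one hgmeas hgnonneg zero_le_one 0 1)] at hone
  rw [← restrict_Ioc_eq_restrict_Icc]
  filter_upwards [hone] with u hu
  simp only [Pi.zero_apply, one_mul] at hu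
  rcases min_choice (g u) 1 with h | h
  · rwa [h] at hu
  · rw [h] at hu
    norm_num at hu
end
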